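/- Let Λ be a family of Borel probability measures on [0,1]^d, let β > 0, C > 0, and set F = H^β(ℝ^d, ℝ, C). For every d⋆ > d*_β(Λ), the β-upper Wasserstein dimension of the family Λ, there exist n₀ ∈ ℕ and a constant K > 0 such that for all n ≥ n₀, sup_{μ ∈ Λ} E ‖μ̂_n − μ‖_F ≤ K n^{-β/d⋆}, where for each μ the expectation is over X_1, …, X_n i.i.d. with law μ. -/

import Mathlib

open Filter Topology MeasureTheory Set
open scoped ENNReal NNReal

noncomputable section

/-- Minimal number of closed balls of radius `ε` needed to cover `S`. -/
def coverN {X : Type*} [PseudoMetricSpace X] (ε : ℝ) (S : Set X) : ℕ∞ :=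
  ⨅ (t : Finset X) (_ : S ⊆ ⋃ x ∈ t, Metric.closedBall x ε), (t.card : ℕ∞)

/-- The `(ε,τ)`-covering number of a measure `μ`. -/
def measCoverN {X : Type*} [PseudoMetricSpace X] [MeasurableSpace X]
    (μ : Measure X) (ε τ : ℝ) : ℕ∞ :=
  ⨅ (S : Set X) (_ : MeasurableSet S) (_ : ENNReal.ofReal (1 - τ) ≤ μ S), coverN ε S

/-- Extended logarithm `ℝ≥0∞ → EReal`. -/
def elog (x : ℝ≥0∞) : EReal :=
  if x = 0 then ⊥ else if x = ⊤ then ⊤ else ((Real.log x.toReal : ℝ) : EReal)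

/-- `log N / log (1/ε)` as an extended real. -/
def dimRatio (N : ℕ∞) (ε : ℝ) : EReal :=
  elog (N : ℝ≥0∞) * (((Real.log (1 / ε))⁻¹ : ℝ) : EReal)

/-- The `α`-entropic dimension of a measure. -/
def entropicDim {X : Type*} [PseudoMetricSpace X] [MeasurableSpace X]
    (μ : Measure X) (α : ℝ) : EReal :=
  limsup (fun ε : ℝ => dimRatio (measCoverN μ ε (ε ^ α)) ε) (𝓝[>] (0 : ℝ))

/-- The `α`-upper Wasserstein dimension of a measure. -/
def upperWDim {X : Type*} [PseudoMetricSpace X] [MeasurableSpace X]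
    (μ : Measure X) (α : ℝ) : EReal :=
  sInf {x : EReal | ∃ s : ℝ, x = (s : EReal) ∧ 2 * α < s ∧
    limsup (fun ε : ℝ => dimRatio (measCoverN μ ε (ε ^ (s * α / (s - 2 * α)))) ε)
      (𝓝[>] (0 : ℝ)) ≤ (s : EReal)}

/-- The lower Wasserstein dimension of a measure. -/
def lowerWDim {X : Type*} [PseudoMetricSpace X] [MeasurableSpace X]
    (μ : Measure X) : EReal :=
  limsup (fun τ : ℝ =>
    liminf (fun ε : ℝ => dimRatio (measCoverN μ ε τ) ε) (𝓝[>] (0 : ℝ))) (𝓝[>] (0 : ℝ))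

/-- The support of a measure: points all of whose neighbourhoods have positive mass. -/
def msupport {X : Type*} [PseudoMetricSpace X] [MeasurableSpace X] (μ : Measure X) : Set X :=
  {x | ∀ r : ℝ, 0 < r → 0 < μ (Metric.ball x r)}

/-- The upper Minkowski dimension of (the support of) a measure. -/
def minkowskiDim {X : Type*} [PseudoMetricSpace X] [MeasurableSpace X]
    (μ : Measure X) : EReal :=
  limsup (fun ε : ℝ => dimRatio (coverN ε (msupport μ)) ε) (𝓝[>] (0 : ℝ))

/-- The upper packing dimension of a measure. -/
def packingDim {X : Type*} [PseudoMetricSpace X] [MeasurableSpace X]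
    (μ : Measure X) : EReal :=
  essSup (fun x =>
    limsup (fun r : ℝ => elog (μ (Metric.closedBall x r)) * (((Real.log r)⁻¹ : ℝ) : EReal))
      (𝓝[>] (0 : ℝ))) μ

/-- The lower regularity dimension of a measure. -/
def lowerRegDim {X : Type*} [PseudoMetricSpace X] [MeasurableSpace X]
    (μ : Measure X) : EReal :=
  sSup {x : EReal | ∃ s : ℝ, x = (s : EReal) ∧ ∃ C : ℝ, 0 < C ∧
    ∀ x0 ∈ msupport μ, ∀ r R : ℝ, 0 < r → r < R →
      ENNReal.ofReal (C * (R / r) ^ s) ≤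
        μ (Metric.closedBall x0 R) / μ (Metric.closedBall x0 r)}

/-- Partial derivative in coordinate `i`. -/
def pderiv' {d : ℕ} (i : Fin d) (f : (Fin d → ℝ) → ℝ) : (Fin d → ℝ) → ℝ :=
  fun x => fderiv ℝ f x (Pi.single i 1)

/-- Multi-index partial derivative `∂^s f`. -/
def mpderiv {d : ℕ} (s : Fin d → ℕ) (f : (Fin d → ℝ) → ℝ) : (Fin d → ℝ) → ℝ :=
  (List.finRange d).foldr (fun i g => (pderiv' i)^[s i] g) f

/-- The `β`-Hölder norm of `f : ℝ^d → ℝ` (with `ℓ∞` distances), valued in `ℝ≥0∞`. -/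
def holderNorm {d : ℕ} (β : ℝ) (f : (Fin d → ℝ) → ℝ) : ℝ≥0∞ :=
  (∑' s : {s : Fin d → ℕ // ∑ i, s i ≤ ⌊β⌋₊}, ⨆ x : Fin d → ℝ, (‖mpderiv s.1 f x‖₊ : ℝ≥0∞)) +
  ∑' s : {s : Fin d → ℕ // ∑ i, s i = ⌊β⌋₊}, ⨆ (x : Fin d → ℝ) (y : Fin d → ℝ) (_ : x ≠ y),
      (‖mpderiv s.1 f x - mpderiv s.1 f y‖₊ : ℝ≥0∞) / (nndist x y : ℝ≥0∞) ^ (β - (⌊β⌋₊ : ℝ))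

/-- The class `H^β(ℝ^d, ℝ, C)` of `β`-Hölder functions with norm at most `C`. -/
def HolderClass (d : ℕ) (β C : ℝ) : Set ((Fin d → ℝ) → ℝ) :=
  {f | ContDiff ℝ (⌊β⌋₊ : ℕ) f ∧ holderNorm β f ≤ ENNReal.ofReal C}

/-- The integral probability metric `‖P - Q‖_F`. -/
def ipm {X : Type*} [MeasurableSpace X] (F : Set (X → ℝ)) (P Q : Measure X) : ℝ :=
  ⨆ f : F, |∫ x, f.1 x ∂P - ∫ x, f.1 x ∂Q|

/-- The empirical measure of a sample `x : Fin n → X`. -/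
def empMeas {X : Type*} [MeasurableSpace X] {n : ℕ} (x : Fin n → X) : Measure X :=
  (n : ℝ≥0∞)⁻¹ • ∑ i : Fin n, Measure.dirac (x i)

/-- Total variation distance between two measures. -/
def tvDist {X : Type*} [MeasurableSpace X] (P Q : Measure X) : ℝ :=
  ⨆ A : {A : Set X // MeasurableSet A}, |(P A.1).toReal - (Q A.1).toReal|

end

open Filter Topology MeasureTheory Set
open scoped ENNReal

/-- `(ε,τ)`-covering number of a family of measures: the minimal number of closed `ε`-balls
needed to cover a single Borel set carrying mass at least `1 - τ` under every member. -/
noncomputable def measCoverNFam {X : Type*} [PseudoMetricSpace X] [MeasurableSpace X]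
    (Λ : Set (Measure X)) (ε τ : ℝ) : ℕ∞ :=
  ⨅ (S : Set X) (_ : MeasurableSet S) (_ : ∀ μ ∈ Λ, ENNReal.ofReal (1 - τ) ≤ μ S), coverN ε S

/-- The `α`-upper Wasserstein dimension of a family of measures. -/
noncomputable def upperWDimFam {X : Type*} [PseudoMetricSpace X] [MeasurableSpace X]
    (Λ : Set (Measure X)) (α : ℝ) : EReal :=
  sInf {x : EReal | ∃ s : ℝ, x = (s : EReal) ∧ 2 * α < s ∧
    Filter.limsup (fun ε : ℝ => dimRatio (measCoverNFam Λ ε (ε ^ (s * α / (s - 2 * α)))) ε)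
      (𝓝[>] (0 : ℝ)) ≤ (s : EReal)}

/-- Successive partial derivatives along a list of coordinate directions. -/
noncomputable def iterPderiv {d : ℕ} (l : List (Fin d)) (f : (Fin d → ℝ) → ℝ) :
    (Fin d → ℝ) → ℝ :=
  l.foldr pderiv' f

lemma contDiff_pderiv' {d k : ℕ} (i : Fin d) {f : (Fin d → ℝ) → ℝ}
    (hf : ContDiff ℝ (k + 1 : ℕ) f) : ContDiff ℝ k (pderiv' i f) :=
  (hf.fderiv_right (m := k) (by exact_mod_cast le_rfl)).clm_apply contDiff_const

lemma contDiff_iterPderiv {d k : ℕ} (l : List (Fin d)) {f : (Fin d → ℝ) → ℝ}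
    (hf : ContDiff ℝ (k + l.length : ℕ) f) : ContDiff ℝ k (iterPderiv l f) := by
  induction l generalizing k with
  | nil => exact hf
  | cons i l ih =>
    refine contDiff_pderiv' i (ih ?_)
    rwa [List.length_cons, ← add_assoc, add_right_comm] at hf

lemma pderiv'_comm {d : ℕ} (i j : Fin d) {f : (Fin d → ℝ) → ℝ} (hf : ContDiff ℝ 2 f) :
    pderiv' i (pderiv' j f) = pderiv' j (pderiv' i f) := by
  have hd : Differentiable ℝ (fderiv ℝ f) :=
    (hf.fderiv_right (m := 1) (by norm_num)).differentiable (by norm_num)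
  have key : ∀ (a b : Fin d) (x : Fin d → ℝ),
      pderiv' a (pderiv' b f) x
        = fderiv ℝ (fderiv ℝ f) x (Pi.single a 1) (Pi.single b 1) := by
    intro a b x
    have h := (hd x).hasFDerivAt.clm_apply (hasFDerivAt_const (Pi.single b (1 : ℝ) : Fin d → ℝ) x)
    change fderiv ℝ (fun y => fderiv ℝ f y (Pi.single b 1)) x (Pi.single a 1) = _
    simp [h.fderiv]
  funext x
  rw [key, key]
  exact (hf.contDiffAt.isSymmSndFDerivAt (by simp)) _ _

lemma iterPderiv_perm {d : ℕ} {l l' : List (Fin d)} (h : l.Perm l') {f : (Fin d → ℝ) → ℝ}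
    (hf : ContDiff ℝ l.length f) : iterPderiv l f = iterPderiv l' f := by
  induction h with
  | nil => rfl
  | cons i _ ih =>
    exact congrArg (pderiv' i) (ih (hf.of_le (by simp)))
  | swap i j l =>
    refine pderiv'_comm j i (contDiff_iterPderiv (k := 2) l ?_)
    convert hf using 2
    simp; ring
  | trans h₁ _ ih₁ ih₂ => exact (ih₁ hf).trans (ih₂ (h₁.length_eq ▸ hf))

lemma mpderiv_eq_iterPderiv {d : ℕ} (s : Fin d → ℕ) (f : (Fin d → ℝ) → ℝ) :
    mpderiv s f = iterPderiv ((List.finRange d).flatMap fun i => List.replicate (s i) i) f := by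
  have hrep : ∀ (i : Fin d) (k : ℕ) (g : (Fin d → ℝ) → ℝ),
      (pderiv' i)^[k] g = (List.replicate k i).foldr pderiv' g := by
    intro i k g
    induction k with
    | zero => rfl
    | succ k ih => rw [Function.iterate_succ_apply', ih, List.replicate_succ, List.foldr_cons]
  unfold mpderiv iterPderiv
  induction List.finRange d with
  | nil => rfl
  | cons i l ih => rw [List.foldr_cons, ih, List.flatMap_cons, List.foldr_append, hrep]

lemma iterPderiv_eq_mpderiv {d : ℕ} (l : List (Fin d)) {f : (Fin d → ℝ) → ℝ}
    (hf : ContDiff ℝ l.length f) : iterPderiv l f = mpderiv (fun i => l.count i) f := by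
  rw [mpderiv_eq_iterPderiv]
  refine iterPderiv_perm ?_ hf
  rw [List.perm_iff_count]
  intro i
  rw [List.count_flatMap, ← Fin.sum_univ_def]
  simp [List.count_replicate]

lemma hasDerivAt_comp_line {d : ℕ} {f : (Fin d → ℝ) → ℝ} (hf : Differentiable ℝ f)
    (c h : Fin d → ℝ) (t : ℝ) :
    HasDerivAt (fun t : ℝ => f (c + t • h)) (∑ i, h i * pderiv' i f (c + t • h)) t := by
  have hl : HasDerivAt (fun t : ℝ => c + t • h) h t := by
    simpa using ((hasDerivAt_id t).smul_const h).const_add c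
  refine ((hf (c + t • h)).hasFDerivAt.comp_hasDerivAt t hl).congr_deriv ?_
  rw [show fderiv ℝ f (c + t • h) h = ∑ i, fderiv ℝ f (c + t • h) (Pi.single i (h i)) by
    rw [← map_sum, Finset.univ_sum_single]]
  refine Finset.sum_congr rfl fun i _ => ?_
  have : (Pi.single i (h i) : Fin d → ℝ) = h i • Pi.single i (1 : ℝ) := by
    rw [← Pi.single_smul]; simp
  rw [this, map_smul]
  rfl

lemma iteratedDeriv_comp_line {d m : ℕ} {f : (Fin d → ℝ) → ℝ} (hf : ContDiff ℝ m f)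
    (c h : Fin d → ℝ) {k : ℕ} (hk : k ≤ m) (t : ℝ) :
    iteratedDeriv k (fun t : ℝ => f (c + t • h)) t
      = ∑ σ : Fin k → Fin d, (∏ j, h (σ j)) * iterPderiv (List.ofFn σ) f (c + t • h) := by
  induction k generalizing t with
  | zero => simp [iterPderiv]
  | succ k ih =>
    rw [iteratedDeriv_succ, funext fun t => ih (by omega) t]
    have hd : ∀ σ : Fin k → Fin d, Differentiable ℝ (iterPderiv (List.ofFn σ) f) := fun σ =>
      (contDiff_iterPderiv (k := 1) _ (hf.of_le (by
        rw [List.length_ofFn]; exact_mod_cast (by omega)))).differentiable (by norm_num)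
    have := HasDerivAt.fun_sum (u := Finset.univ) fun (σ : Fin k → Fin d) _ =>
      (hasDerivAt_comp_line (hd σ) c h t).const_mul (∏ j, h (σ j))
    rw [this.deriv, ← (Fin.consEquiv fun _ => Fin d).sum_comp, Fintype.sum_prod_type,
      Finset.sum_comm]
    refine Finset.sum_congr rfl fun σ _ => ?_
    rw [Finset.mul_sum]
    refine Finset.sum_congr rfl fun i _ => ?_
    simp [Fin.prod_univ_succ, iterPderiv, Fin.consEquiv]
    ring

lemma abs_le_of_mem_holderClass {d : ℕ} {β C : ℝ} (hC : 0 < C) {f : (Fin d → ℝ) → ℝ}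
    (hf : f ∈ HolderClass d β C) (x : Fin d → ℝ) : |f x| ≤ C := by
  have h0 : mpderiv (0 : Fin d → ℕ) f = f := by
    rw [mpderiv_eq_iterPderiv, List.flatMap_eq_nil_iff.2 (by simp)]; rfl
  have h : (‖f x‖₊ : ℝ≥0∞) ≤ ENNReal.ofReal C := by
    refine le_trans ?_ ((le_self_add.trans le_rfl).trans hf.2)
    refine le_trans ?_ (ENNReal.le_tsum (⟨0, by simp⟩ : {s : Fin d → ℕ // ∑ i, s i ≤ ⌊β⌋₊}))
    refine le_trans ?_ (le_iSup _ x)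
    simp [h0]
  rw [← Real.norm_eq_abs]
  simpa [ENNReal.ofReal, ← NNReal.coe_le_coe, hC.le] using h

lemma abs_iterPderiv_sub_le_of_mem_holderClass {d : ℕ} {β C : ℝ} (hC : 0 < C)
    {f : (Fin d → ℝ) → ℝ} (hf : f ∈ HolderClass d β C) {l : List (Fin d)} (hl : l.length = ⌊β⌋₊)
    (x y : Fin d → ℝ) :
    |iterPderiv l f x - iterPderiv l f y| ≤ C * ‖x - y‖ ^ (β - ⌊β⌋₊) := by
  rcases eq_or_ne x y with rfl | hxy
  · simp only [sub_self, abs_zero]; positivity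
  rw [iterPderiv_eq_mpderiv l (hl ▸ hf.1)]
  set s : Fin d → ℕ := fun i => l.count i
  have hs : ∑ i, s i = ⌊β⌋₊ := by
    rw [← hl]
    simpa [s] using Multiset.sum_count_eq_card (s := Finset.univ) (m := (l : Multiset (Fin d)))
  have h : (‖mpderiv s f x - mpderiv s f y‖₊ : ℝ≥0∞) / (nndist x y : ℝ≥0∞) ^ (β - (⌊β⌋₊ : ℝ))
      ≤ ENNReal.ofReal C := by
    refine le_trans ?_ ((le_add_self.trans le_rfl).trans hf.2)
    refine le_trans ?_ (ENNReal.le_tsum (⟨s, hs⟩ : {s : Fin d → ℕ // ∑ i, s i = ⌊β⌋₊}))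
    exact le_iSup_of_le x (le_iSup_of_le y (le_iSup_of_le hxy le_rfl))
  have hpos : 0 < nndist x y := by
    rw [← NNReal.coe_pos, coe_nndist]; exact dist_pos.2 hxy
  rw [← ENNReal.coe_rpow_of_ne_zero hpos.ne', ENNReal.div_le_iff
    (by simpa using (NNReal.rpow_pos hpos).ne') (by simp), ENNReal.ofReal, ← ENNReal.coe_mul,
    ENNReal.coe_le_coe, ← NNReal.coe_le_coe] at h
  simpa [hC.le, dist_eq_norm] using h

lemma taylor_lagrange_range {g : ℝ → ℝ} {m : ℕ} (hg : ContDiff ℝ m g) :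
    ∃ ξ ∈ Icc (0 : ℝ) 1, g 1 = ∑ k ∈ Finset.range m, (k.factorial : ℝ)⁻¹ * iteratedDeriv k g 0
      + (m.factorial : ℝ)⁻¹ * iteratedDeriv m g ξ := by
  cases m with
  | zero => exact ⟨1, by simp, by simp⟩
  | succ n =>
    obtain ⟨ξ, hξ, h⟩ := taylor_mean_remainder_lagrange_iteratedDeriv (f := g) (x := 1) (x₀ := 0)
      (n := n) zero_ne_one (by exact_mod_cast hg.contDiffOn)
    rw [uIoo_of_le zero_le_one] at hξ
    refine ⟨ξ, Ioo_subset_Icc_self hξ, ?_⟩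
    rw [sub_eq_iff_eq_add', taylor_within_apply] at h
    rw [h]
    congr 1
    · refine Finset.sum_congr rfl fun k hk => ?_
      rw [iteratedDerivWithin_eq_iteratedDeriv (uniqueDiffOn_uIcc zero_ne_one)
        (hg.contDiffAt.of_le (by exact_mod_cast (Finset.mem_range.1 hk).le)) left_mem_uIcc]
      simp
    · simp [div_eq_inv_mul]

lemma abs_sub_taylor_le {d m : ℕ} {γ L : ℝ} (hL : 0 ≤ L) (hγ : 0 ≤ γ) {f : (Fin d → ℝ) → ℝ}
    (hf : ContDiff ℝ m f)
    (hfL : ∀ (σ : Fin m → Fin d) (x y : Fin d → ℝ),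
      |iterPderiv (List.ofFn σ) f x - iterPderiv (List.ofFn σ) f y| ≤ L * ‖x - y‖ ^ γ)
    (c x : Fin d → ℝ) :
    |f x - ∑ k ∈ Finset.range (m + 1), (k.factorial : ℝ)⁻¹ * ∑ σ : Fin k → Fin d,
      (∏ j, (x - c) (σ j)) * iterPderiv (List.ofFn σ) f c|
      ≤ (d : ℝ) ^ m * L * (‖x - c‖ ^ m * ‖x - c‖ ^ γ) := by
  set h := x - c with hh
  have hg : ContDiff ℝ m (fun t : ℝ => f (c + t • h)) :=
    hf.comp (contDiff_const.add (contDiff_id.smul contDiff_const))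
  obtain ⟨ξ, hξ, he⟩ := taylor_lagrange_range hg
  have hx : c + (1 : ℝ) • h = x := by simp [hh]
  rw [hx, iteratedDeriv_comp_line hf c h le_rfl] at he
  have hsum : ∑ k ∈ Finset.range m, (k.factorial : ℝ)⁻¹ *
        iteratedDeriv k (fun t : ℝ => f (c + t • h)) 0
      = ∑ k ∈ Finset.range m, (k.factorial : ℝ)⁻¹ * ∑ σ : Fin k → Fin d,
        (∏ j, h (σ j)) * iterPderiv (List.ofFn σ) f c := by
    refine Finset.sum_congr rfl fun k hk => ?_
    rw [iteratedDeriv_comp_line hf c h (Finset.mem_range.1 hk).le]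
    simp
  rw [he, hsum, Finset.sum_range_succ, add_sub_add_left_eq_sub, ← mul_sub,
    ← Finset.sum_sub_distrib, abs_mul]
  have hfac : |(m.factorial : ℝ)⁻¹| ≤ 1 := by
    rw [abs_of_nonneg (by positivity)]
    exact inv_le_one_of_one_le₀ (by exact_mod_cast m.factorial_pos)
  refine (mul_le_of_le_one_left (abs_nonneg _) hfac).trans ?_
  refine (Finset.abs_sum_le_sum_abs _ _).trans ?_
  have hterm : ∀ σ : Fin m → Fin d,
      |(∏ j, h (σ j)) * iterPderiv (List.ofFn σ) f (c + ξ • h)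
        - (∏ j, h (σ j)) * iterPderiv (List.ofFn σ) f c| ≤ L * (‖h‖ ^ m * ‖h‖ ^ γ) := by
    intro σ
    rw [← mul_sub, abs_mul, Finset.abs_prod, mul_left_comm]
    have h1 : ∏ j, |h (σ j)| ≤ ‖h‖ ^ m := by
      refine (Finset.prod_le_prod (fun _ _ => abs_nonneg _)
        fun j _ => norm_le_pi_norm h (σ j)).trans ?_
      simp
    refine mul_le_mul h1 ((hfL σ _ _).trans ?_) (abs_nonneg _) (by positivity)
    have h2 : ‖c + ξ • h - c‖ ≤ ‖h‖ := by
      rw [add_sub_cancel_left, norm_smul, Real.norm_of_nonneg hξ.1]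
      exact mul_le_of_le_one_left (norm_nonneg _) hξ.2
    gcongr
  refine (Finset.sum_le_card_nsmul _ _ _ fun σ _ => hterm σ).trans (le_of_eq ?_)
  simp
  ring

/-- Monomials of degree at most `m`, indexed by words in the letters `none` (the constant `1`) and
`some i` (the `i`-th coordinate). -/
def wordMonomial {d m : ℕ} (σ : Fin m → Option (Fin d)) (y : Fin d → ℝ) : ℝ :=
  ∏ j, (σ j).elim 1 y

/-- The space of polynomial functions of degree at most `m` on `ℝ^d`. -/
def polySpace (d m : ℕ) : Submodule ℝ ((Fin d → ℝ) → ℝ) :=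
  Submodule.span ℝ (Set.range (wordMonomial (d := d) (m := m)))

lemma continuous_wordMonomial {d m : ℕ} (σ : Fin m → Option (Fin d)) :
    Continuous (wordMonomial σ) := by
  refine continuous_finsetProd _ fun j _ => ?_
  cases σ j with
  | none => exact continuous_const
  | some i => exact continuous_apply i

lemma abs_wordMonomial_le_one {d m : ℕ} (σ : Fin m → Option (Fin d)) {y : Fin d → ℝ}
    (hy : ‖y‖ ≤ 1) : |wordMonomial σ y| ≤ 1 := by
  rw [wordMonomial, Finset.abs_prod]
  refine Finset.prod_le_one (fun _ _ => abs_nonneg _) fun j _ => ?_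
  cases σ j with
  | none => simp
  | some i => exact (norm_le_pi_norm y i).trans hy

lemma prod_affine_mem_polySpace {d m : ℕ} (w : Fin m → Option (Fin d) → ℝ) :
    (fun y : Fin d → ℝ => ∏ j, ∑ i, w j i * i.elim 1 y) ∈ polySpace d m := by
  have : (fun y : Fin d → ℝ => ∏ j, ∑ i, w j i * i.elim 1 y)
      = ∑ σ : Fin m → Option (Fin d), (∏ j, w j (σ j)) • wordMonomial σ := by
    funext y
    rw [Finset.prod_univ_sum, Fintype.piFinset_univ, Finset.sum_apply]
    exact Finset.sum_congr rfl fun σ _ => by simp [wordMonomial, Finset.prod_mul_distrib]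
  rw [this]
  exact Submodule.sum_mem _ fun σ _ => Submodule.smul_mem _ _ (Submodule.subset_span ⟨σ, rfl⟩)

lemma comp_affine_mem_polySpace {d m : ℕ} {p : (Fin d → ℝ) → ℝ} (hp : p ∈ polySpace d m)
    (c : Fin d → ℝ) (r : ℝ) : (fun y => p (c + r • y)) ∈ polySpace d m := by
  induction hp using Submodule.span_induction with
  | mem p hp =>
    obtain ⟨σ, rfl⟩ := hp
    convert prod_affine_mem_polySpace (d := d) (m := m) fun j i =>
      (σ j).elim (i.elim 1 0) fun a => i.elim (c a) fun b => if b = a then r else 0 using 2 with y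
    unfold wordMonomial
    refine Finset.prod_congr rfl fun j _ => ?_
    rw [Fintype.sum_option]
    cases σ j <;> simp
  | zero => exact Submodule.zero_mem _
  | add p q _ _ hp hq => exact Submodule.add_mem _ hp hq
  | smul a p _ hp => exact Submodule.smul_mem _ a hp

lemma taylor_monomial_mem_polySpace {d m k : ℕ} (hk : k ≤ m) (σ : Fin k → Fin d)
    (c : Fin d → ℝ) : (fun x : Fin d → ℝ => ∏ j, (x - c) (σ j)) ∈ polySpace d m := by
  obtain ⟨l, rfl⟩ := Nat.exists_eq_add_of_le hk
  convert prod_affine_mem_polySpace (d := d) (m := k + l)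
    (Fin.append (fun j i => i.elim (-c (σ j)) fun b => if b = σ j then 1 else 0)
      (fun _ i => i.elim 1 0)) using 2 with x
  rw [Fin.prod_univ_add]
  simp only [Fin.append_left, Fin.append_right, Fintype.sum_option]
  simp [sub_eq_neg_add]

lemma LinearMap.exists_bounded_preimage {E F : Type*} [NormedAddCommGroup E] [NormedSpace ℝ E]
    [FiniteDimensional ℝ E] [NormedAddCommGroup F] [NormedSpace ℝ F] (Φ : E →ₗ[ℝ] F) :
    ∃ M : ℝ, 0 < M ∧ ∀ e, ∃ a, Φ a = Φ e ∧ ‖a‖ ≤ M * ‖Φ e‖ := by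
  obtain ⟨R, hR⟩ := Φ.rangeRestrict.exists_rightInverse_of_surjective Φ.range_rangeRestrict
  let R' : Φ.range →L[ℝ] E := LinearMap.toContinuousLinearMap R
  refine ⟨‖R'‖ + 1, by positivity, fun e => ⟨R (Φ.rangeRestrict e), ?_, ?_⟩⟩
  · exact congrArg Subtype.val (LinearMap.congr_fun hR (Φ.rangeRestrict e))
  · refine (R'.le_opNorm (Φ.rangeRestrict e)).trans ?_
    change ‖R'‖ * ‖Φ e‖ ≤ _
    gcongr
    exact le_add_of_nonneg_right zero_le_one

/-- Coefficients of a polynomial are controlled by its supremum on the unit ball. -/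
lemma exists_coeff_bound_unitBall (d m : ℕ) :
    ∃ M : ℝ, 0 < M ∧ ∀ p ∈ polySpace d m, ∀ B : ℝ, 0 ≤ B → (∀ y, ‖y‖ ≤ 1 → |p y| ≤ B) →
      ∃ a : (Fin m → Option (Fin d)) → ℝ, (∀ σ, |a σ| ≤ M * B) ∧
        ∀ y, ‖y‖ ≤ 1 → p y = ∑ σ, a σ * wordMonomial σ y := by
  let U := Metric.closedBall (0 : Fin d → ℝ) 1
  have : CompactSpace U := isCompact_iff_compactSpace.1 (isCompact_closedBall _ _)
  let ψ : (Fin m → Option (Fin d)) → C(U, ℝ) := fun σ =>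
    ⟨fun y => wordMonomial σ y, (continuous_wordMonomial σ).comp continuous_subtype_val⟩
  let Φ := Fintype.linearCombination ℝ ψ
  have hΦ : ∀ a (y : U), Φ a y = ∑ σ, a σ * wordMonomial σ y := by
    intro a y
    simp [Φ, Fintype.linearCombination_apply, ψ]
  obtain ⟨M, hM, h⟩ := LinearMap.exists_bounded_preimage Φ
  refine ⟨M, hM, fun p hp B hB hpB => ?_⟩
  obtain ⟨a₀, rfl⟩ := (Submodule.mem_span_range_iff_exists_fun ℝ).1 hp
  have hp' : ∀ y : U, Φ a₀ y = (∑ σ, a₀ σ • wordMonomial σ) y.1 := fun y => by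
    rw [hΦ]; simp
  obtain ⟨a, ha, han⟩ := h a₀
  have hn : ‖Φ a₀‖ ≤ B := (ContinuousMap.norm_le _ hB).2 fun y => by
    rw [hp', Real.norm_eq_abs]
    exact hpB _ (mem_closedBall_zero_iff.1 y.2)
  refine ⟨a, fun σ => ?_, fun y hy => ?_⟩
  · exact (norm_le_pi_norm a σ).trans (han.trans (by gcongr))
  · let z : U := ⟨y, mem_closedBall_zero_iff.2 hy⟩
    rw [← hΦ a z, ha, hp']

lemma exists_coeff_bound (d m : ℕ) :
    ∃ M : ℝ, 0 < M ∧ ∀ p ∈ polySpace d m, ∀ (c : Fin d → ℝ) (r B : ℝ), 0 < r → 0 ≤ B →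
      (∀ x, ‖x - c‖ ≤ r → |p x| ≤ B) →
      ∃ a : (Fin m → Option (Fin d)) → ℝ, (∀ σ, |a σ| ≤ M * B) ∧
        ∀ x, ‖x - c‖ ≤ r → p x = ∑ σ, a σ * wordMonomial σ (r⁻¹ • (x - c)) := by
  obtain ⟨M, hM, h⟩ := exists_coeff_bound_unitBall d m
  refine ⟨M, hM, fun p hp c r B hr hB hpB => ?_⟩
  obtain ⟨a, ha, hpa⟩ := h _ (comp_affine_mem_polySpace hp c r) B hB fun y hy => hpB _ (by
    rw [add_sub_cancel_left, norm_smul, Real.norm_of_nonneg hr.le]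
    exact mul_le_of_le_one_right hr.le hy)
  refine ⟨a, ha, fun x hx => ?_⟩
  rw [← hpa _ (by
    rw [norm_smul, norm_inv, Real.norm_of_nonneg hr.le, inv_mul_le_iff₀ hr]; simpa using hx)]
  rw [smul_inv_smul₀ hr.ne', add_sub_cancel]

/-- Hölder functions are approximated by polynomials around every point. -/
lemma exists_poly_approx {d : ℕ} {β C : ℝ} (hβ : 0 < β) (hC : 0 < C) {f : (Fin d → ℝ) → ℝ}
    (hf : f ∈ HolderClass d β C) (c : Fin d → ℝ) :
    ∃ p ∈ polySpace d ⌊β⌋₊, ∀ x, |f x - p x| ≤ (d : ℝ) ^ ⌊β⌋₊ * C * ‖x - c‖ ^ β := by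
  have hfl : (⌊β⌋₊ : ℝ) ≤ β := Nat.floor_le hβ.le
  refine ⟨fun x => ∑ k ∈ Finset.range (⌊β⌋₊ + 1), (k.factorial : ℝ)⁻¹ * ∑ σ : Fin k → Fin d,
      (∏ j, (x - c) (σ j)) * iterPderiv (List.ofFn σ) f c, ?_, fun x => ?_⟩
  · have : (fun x : Fin d → ℝ => ∑ k ∈ Finset.range (⌊β⌋₊ + 1), (k.factorial : ℝ)⁻¹ *
        ∑ σ : Fin k → Fin d, (∏ j, (x - c) (σ j)) * iterPderiv (List.ofFn σ) f c)
        = ∑ k ∈ Finset.range (⌊β⌋₊ + 1), (k.factorial : ℝ)⁻¹ • ∑ σ : Fin k → Fin d,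
          iterPderiv (List.ofFn σ) f c • fun x : Fin d → ℝ => ∏ j, (x - c) (σ j) := by
      funext x
      simp [Finset.sum_apply, mul_comm]
    rw [this]
    refine Submodule.sum_mem _ fun k hk => Submodule.smul_mem _ _ (Submodule.sum_mem _ fun σ _ =>
      Submodule.smul_mem _ _ (taylor_monomial_mem_polySpace ?_ σ c))
    exact Nat.lt_succ_iff.1 (Finset.mem_range.1 hk)
  · have h := abs_sub_taylor_le hC.le (sub_nonneg.2 hfl) hf.1
      (fun σ => abs_iterPderiv_sub_le_of_mem_holderClass hC hf (List.length_ofFn)) c x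
    rwa [← Real.rpow_natCast ‖x - c‖, ← Real.rpow_add' (norm_nonneg _) (by simpa using hβ.ne'),
      add_sub_cancel] at h

lemma exists_simpleFunc_of_cover {X : Type*} [PseudoMetricSpace X] [MeasurableSpace X]
    [OpensMeasurableSpace X] [Nonempty X] (T : Finset X) (ε : ℝ) :
    ∃ π : SimpleFunc X X, ∀ x ∈ ⋃ c ∈ T, Metric.closedBall c ε, π x ∈ T ∧ dist x (π x) ≤ ε := by
  classical
  induction T using Finset.induction_on with
  | empty => exact ⟨SimpleFunc.const X (Classical.arbitrary X), by simp⟩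
  | insert c T _ ih =>
    obtain ⟨π, hπ⟩ := ih
    refine ⟨SimpleFunc.piecewise (Metric.closedBall c ε) Metric.isClosed_closedBall.measurableSet
      (SimpleFunc.const X c) π, fun x hx => ?_⟩
    rw [SimpleFunc.coe_piecewise]
    by_cases hxc : x ∈ Metric.closedBall c ε
    · simpa [Set.piecewise_eq_of_mem _ _ _ hxc] using hxc
    · rw [Set.piecewise_eq_of_notMem _ _ _ hxc]
      simp only [Finset.mem_insert, iUnion_iUnion_eq_or_left, mem_union, hxc, false_or] at hx
      exact ⟨Finset.mem_insert_of_mem (hπ x hx).1, (hπ x hx).2⟩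

lemma exists_parent {X : Type*} [PseudoMetricSpace X] {S : Set X} {T : Finset X} {π : X → X}
    {r ε : ℝ} (hr : ∀ x ∈ S, dist x (π x) ≤ r) (hS : S ⊆ ⋃ c ∈ T, Metric.closedBall c ε) :
    ∃ par : X → X, ∀ x ∈ S, par (π x) ∈ T ∧ dist (π x) (par (π x)) ≤ r + ε := by
  have : ∀ c, ∃ c', (∃ x ∈ S, π x = c) → c' ∈ T ∧ dist c c' ≤ r + ε := by
    intro c
    by_cases h : ∃ x ∈ S, π x = c
    · obtain ⟨x, hx, rfl⟩ := h
      obtain ⟨c', hc', hxc⟩ := mem_iUnion₂.1 (hS hx)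
      refine ⟨c', fun _ => ⟨hc', (dist_triangle_left _ _ x).trans (add_le_add (hr x hx) hxc)⟩⟩
    · exact ⟨c, fun h' => absurd h' h⟩
  choose par hpar using this
  exact ⟨par, fun x hx => hpar _ ⟨x, hx, rfl⟩⟩

/-- Coverings at geometrically increasing scales can be organised into a tree of cells, the maps
`π j` sending a point to the centre of its cell and `par j` a centre to its parent. -/
lemma exists_covering_tree {X : Type*} [PseudoMetricSpace X] [MeasurableSpace X]
    [OpensMeasurableSpace X] [Nonempty X] {S : Set X} {T : ℕ → Finset X} {η : ℝ} (hη : 0 ≤ η)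
    (J : ℕ) (hS : ∀ j ≤ J, S ⊆ ⋃ c ∈ T j, Metric.closedBall c (η * 4 ^ j)) :
    ∃ (π : ℕ → SimpleFunc X X) (par : ℕ → X → X),
      (∀ j ≤ J, ∀ x ∈ S, π j x ∈ T j ∧ dist x (π j x) ≤ 2 * (η * 4 ^ j)) ∧
      ∀ j < J, ∀ x ∈ S, π (j + 1) x = par j (π j x) ∧
        dist (π j x) (par j (π j x)) ≤ 6 * (η * 4 ^ j) := by
  induction J with
  | zero =>
    obtain ⟨π, hπ⟩ := exists_simpleFunc_of_cover (T 0) (η * 4 ^ 0)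
    refine ⟨fun _ => π, fun _ => id, fun j hj x hx => ?_, fun j hj => absurd hj (by omega)⟩
    obtain rfl : j = 0 := by omega
    obtain ⟨h1, h2⟩ := hπ x (hS 0 le_rfl hx)
    exact ⟨h1, h2.trans (le_mul_of_one_le_left (by positivity) one_le_two)⟩
  | succ J ih =>
    obtain ⟨π, par, h1, h2⟩ := ih fun j hj => hS j (by omega)
    obtain ⟨p, hp⟩ := exists_parent (fun x hx => (h1 J le_rfl x hx).2) (hS (J + 1) le_rfl)
    refine ⟨fun j => if j ≤ J then π j else (π J).map p, fun j => if j < J then par j else p,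
      fun j hj x hx => ?_, fun j hj x hx => ?_⟩
    · rcases Nat.lt_or_ge J j with hj' | hj'
      · obtain rfl : j = J + 1 := by omega
        simp only [if_neg (not_le.2 hj'), SimpleFunc.map_apply]
        refine ⟨(hp x hx).1, (dist_triangle _ (π J x) _).trans ?_⟩
        have := (hp x hx).2
        have := (h1 J le_rfl x hx).2
        rw [pow_succ] at *
        linarith
      · simpa only [if_pos hj'] using h1 j hj' x hx
    · rcases Nat.lt_or_ge j J with hj' | hj'
      · simpa only [if_pos hj', if_pos hj'.le, if_pos (Nat.succ_le_of_lt hj')] using h2 j hj' x hx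
      · obtain rfl : j = J := by omega
        have := (hp x hx).2
        rw [pow_succ] at this
        simp only [le_refl, if_true, lt_irrefl, if_false, SimpleFunc.map_apply,
          if_neg (Nat.not_succ_le_self j), true_and]
        linarith

/-- The multiscale expansion of Hölder functions into localised monomials: `S` is the covered set,
`π j` the cell map at the scale `η * 4 ^ j`. -/
lemma exists_multiscale_expansion (d : ℕ) {β C : ℝ} (hβ : 0 < β) (hC : 0 < C) :
    ∃ A : ℝ, 0 < A ∧ ∀ {S : Set (Fin d → ℝ)} {T : ℕ → Finset (Fin d → ℝ)} {η : ℝ} {J : ℕ}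
      {π : ℕ → (Fin d → ℝ) → (Fin d → ℝ)} {par : ℕ → (Fin d → ℝ) → (Fin d → ℝ)},
      0 < η → η * 4 ^ J ≤ 1 →
      (∀ j ≤ J, ∀ x ∈ S, π j x ∈ T j ∧ dist x (π j x) ≤ 2 * (η * 4 ^ j)) →
      (∀ j < J, ∀ x ∈ S, π (j + 1) x = par j (π j x) ∧
        dist (π j x) (par j (π j x)) ≤ 6 * (η * 4 ^ j)) →
      ∀ f ∈ HolderClass d β C,
        ∃ a : ℕ → (Fin d → ℝ) → (Fin ⌊β⌋₊ → Option (Fin d)) → ℝ,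
          (∀ j c σ, |a j c σ| ≤ A * if j < J then (η * 4 ^ j) ^ β else 1) ∧
          ∀ x, |f x - ∑ j ∈ Finset.range (J + 1), ∑ c ∈ T j, ∑ σ, a j c σ *
            (S ∩ π j ⁻¹' {c}).indicator
              (fun x => wordMonomial σ ((2 * (η * 4 ^ j))⁻¹ • (x - c))) x|
            ≤ Sᶜ.indicator (fun _ => C) x + A * η ^ β := by
  classical
  obtain ⟨M, hM, hcoeff⟩ := exists_coeff_bound d ⌊β⌋₊
  set A₀ : ℝ := (d : ℝ) ^ ⌊β⌋₊ * C with hA₀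
  have hA₀0 : 0 ≤ A₀ := by positivity
  set A : ℝ := (M + 1) * (2 * A₀ * 8 ^ β + C) with hA
  have h8 : (1 : ℝ) ≤ 8 ^ β := Real.one_le_rpow (by norm_num) hβ.le
  have h28 : (2 : ℝ) ^ β ≤ 8 ^ β := Real.rpow_le_rpow (by norm_num) (by norm_num) hβ.le
  refine ⟨A, by positivity, ?_⟩
  intro S T η J π par hη hηJ hπ hpar f hf
  choose p hpmem hp using exists_poly_approx hβ hC hf
  have hε : ∀ j, 0 < η * (4 : ℝ) ^ j := fun j => by positivity
  let q : ℕ → (Fin d → ℝ) → (Fin d → ℝ) → ℝ := fun j c =>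
    if j < J then p c - p (par j c) else p c
  let b : ℕ → ℝ := fun j => if j < J then 2 * A₀ * (8 * (η * 4 ^ j)) ^ β else C + A₀ * 2 ^ β
  have hb : ∀ j, 0 ≤ b j := fun j => by
    simp only [b]; split_ifs <;> positivity
  have hloc : ∀ j c, ∃ a : (Fin ⌊β⌋₊ → Option (Fin d)) → ℝ, (∀ σ, |a σ| ≤ M * b j) ∧
      (j ≤ J → (∃ x ∈ S, π j x = c) → ∀ x, ‖x - c‖ ≤ 2 * (η * 4 ^ j) →
        q j c x = ∑ σ, a σ * wordMonomial σ ((2 * (η * 4 ^ j))⁻¹ • (x - c))) := by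
    intro j c
    by_cases h : j ≤ J ∧ ∃ x ∈ S, π j x = c
    · obtain ⟨hj, z, hz, rfl⟩ := h
      have hq₁ : q j (π j z) ∈ polySpace d ⌊β⌋₊ := by
        simp only [q]
        split_ifs
        · exact Submodule.sub_mem _ (hpmem _) (hpmem _)
        · exact hpmem _
      have hq₂ : ∀ x, ‖x - π j z‖ ≤ 2 * (η * 4 ^ j) → |q j (π j z) x| ≤ b j := by
        intro x hx
        simp only [q, b]
        split_ifs with hjJ
        · have h1 := hp (π j z) x
          have h2 := hp (par j (π j z)) x
          have h3 := (hpar j hjJ z hz).2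
          have h4 : ‖x - par j (π j z)‖ ≤ 8 * (η * 4 ^ j) := by
            rw [← dist_eq_norm] at hx ⊢
            linarith [dist_triangle x (π j z) (par j (π j z))]
          have h5 : ‖x - π j z‖ ≤ 8 * (η * 4 ^ j) := by linarith [hε j]
          have h1' : |f x - p (π j z) x| ≤ A₀ * (8 * (η * 4 ^ j)) ^ β := h1.trans (by gcongr)
          have h2' : |f x - p (par j (π j z)) x| ≤ A₀ * (8 * (η * 4 ^ j)) ^ β :=
            h2.trans (by gcongr)
          rw [abs_le] at *
          constructor <;> simp only [Pi.sub_apply] <;> linarith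
        · have hjJ' : j = J := by omega
          have h1 := hp (π j z) x
          have h0 := abs_le_of_mem_holderClass hC hf x
          have h1' : |f x - p (π j z) x| ≤ A₀ * 2 ^ β := h1.trans (by
            have : ‖x - π j z‖ ≤ 2 := hx.trans (by rw [hjJ']; linarith)
            gcongr)
          rw [abs_le] at *
          constructor <;> linarith
      obtain ⟨a, ha, haq⟩ := hcoeff _ hq₁ (π j z) _ (b j) (by positivity) (hb j) hq₂
      exact ⟨a, ha, fun _ _ => haq⟩
    · exact ⟨0, fun σ => by simpa using mul_nonneg hM.le (hb j), fun h1 h2 => absurd ⟨h1, h2⟩ h⟩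
  choose a ha haq using hloc
  refine ⟨a, fun j c σ => (ha j c σ).trans ?_, fun x => ?_⟩
  · simp only [b]
    split_ifs
    · rw [Real.mul_rpow (by norm_num) (hε j).le]
      have := Real.rpow_nonneg (hε j).le β
      calc M * (2 * A₀ * (8 ^ β * (η * 4 ^ j) ^ β))
          = M * (2 * A₀ * 8 ^ β) * (η * 4 ^ j) ^ β := by ring
        _ ≤ A * (η * 4 ^ j) ^ β := by
          rw [hA]
          gcongr ?_ * ?_ * _ <;> linarith
    · rw [mul_one, hA]
      refine mul_le_mul (by linarith) ?_ (by positivity) (by positivity)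
      nlinarith
  · have hAη : 0 ≤ A * η ^ β := by positivity
    by_cases hx : x ∈ S
    · have hsum : ∑ j ∈ Finset.range (J + 1), ∑ c ∈ T j, ∑ σ, a j c σ *
            (S ∩ π j ⁻¹' {c}).indicator
              (fun x => wordMonomial σ ((2 * (η * 4 ^ j))⁻¹ • (x - c))) x = p (π 0 x) x := by
        have h1 : ∀ j ∈ Finset.range (J + 1), ∑ c ∈ T j, ∑ σ, a j c σ *
            (S ∩ π j ⁻¹' {c}).indicator
              (fun x => wordMonomial σ ((2 * (η * 4 ^ j))⁻¹ • (x - c))) x = q j (π j x) x := by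
          intro j hj
          have hj' : j ≤ J := Nat.lt_succ_iff.1 (Finset.mem_range.1 hj)
          obtain ⟨hT, hd⟩ := hπ j hj' x hx
          rw [Finset.sum_eq_single_of_mem _ hT]
          · rw [haq j (π j x) hj' ⟨x, hx, rfl⟩ x (by rwa [← dist_eq_norm])]
            refine Finset.sum_congr rfl fun σ _ => ?_
            rw [indicator_of_mem (show x ∈ S ∩ π j ⁻¹' {π j x} from ⟨hx, rfl⟩)]
          · intro c _ hc
            refine Finset.sum_eq_zero fun σ _ => ?_
            rw [indicator_of_notMem (fun h => hc h.2.symm), mul_zero]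
        rw [Finset.sum_congr rfl h1, Finset.sum_range_succ]
        have h2 : ∀ j ∈ Finset.range J, q j (π j x) x = p (π j x) x - p (π (j + 1) x) x := by
          intro j hj
          have hj' := Finset.mem_range.1 hj
          rw [(hpar j hj' x hx).1]
          simp [q, hj']
        rw [Finset.sum_congr rfl h2, Finset.sum_range_sub']
        simp [q]
      rw [hsum, indicator_of_notMem (by simpa using hx), zero_add]
      refine (hp (π 0 x) x).trans ?_
      have h3 : ‖x - π 0 x‖ ≤ 2 * η := by simpa [dist_eq_norm] using (hπ 0 J.zero_le x hx).2
      calc A₀ * ‖x - π 0 x‖ ^ β ≤ A₀ * (2 * η) ^ β := by gcongr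
        _ = A₀ * 2 ^ β * η ^ β := by rw [Real.mul_rpow (by norm_num) hη.le]; ring
        _ ≤ A * η ^ β := by
          gcongr
          rw [hA]
          nlinarith [mul_le_mul_of_nonneg_left h28 hA₀0, mul_nonneg hA₀0 (zero_le_one.trans h8)]
    · have h0 : ∀ j c, x ∉ S ∩ π j ⁻¹' {c} := fun j c h => hx h.1
      simp only [indicator_of_notMem (h0 _ _), mul_zero, Finset.sum_const_zero, sub_zero,
        indicator_of_mem (show x ∈ Sᶜ from hx)]
      linarith [abs_le_of_mem_holderClass hC hf x]
section Empirical

open ProbabilityTheory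

variable {X : Type*} [MeasurableSpace X]

lemma integral_empMeas [MeasurableSingletonClass X] {n : ℕ} (x : Fin n → X) (f : X → ℝ) :
    ∫ y, f y ∂(empMeas x) = (n : ℝ)⁻¹ * ∑ k, f (x k) := by
  rw [empMeas, integral_smul_measure, integral_finsetSum_measure
    fun i _ => integrable_dirac (by simp)]
  simp

lemma integral_abs_mean_sub_le {μ : Measure X} [IsProbabilityMeasure μ] {n : ℕ} (hn : 0 < n)
    {ψ : X → ℝ} (hψ : Measurable ψ) {Q : Set X} (hQ : MeasurableSet Q)
    (hψQ : ∀ x, |ψ x| ≤ Q.indicator (fun _ => 1) x) :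
    Integrable (fun x : Fin n → X => |(n : ℝ)⁻¹ * ∑ k, ψ (x k) - ∫ y, ψ y ∂μ|)
        (Measure.pi fun _ => μ) ∧
      ∫ x : Fin n → X, |(n : ℝ)⁻¹ * ∑ k, ψ (x k) - ∫ y, ψ y ∂μ| ∂(Measure.pi fun _ => μ) ≤
        √(μ.real Q / n) := by
  have hn' : (n : ℝ) ≠ 0 := by positivity
  have hψ1 : ∀ x, |ψ x| ≤ 1 := fun x =>
    (hψQ x).trans (indicator_le_self' (fun _ _ => zero_le_one) x)
  have hψL : MemLp ψ 2 μ :=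
    memLp_of_bounded (.of_forall fun x => abs_le.1 (hψ1 x)) hψ.aestronglyMeasurable 2
  set P : Measure (Fin n → X) := Measure.pi fun _ => μ
  set Y : (Fin n → X) → ℝ := fun x => (n : ℝ)⁻¹ * ∑ k, ψ (x k) with hY
  have hYm : Measurable Y := by fun_prop
  have hYL : MemLp Y 2 P := by
    have h : ∀ k : Fin n, MemLp (fun x : Fin n → X => ψ (x k)) 2 P := fun k =>
      hψL.comp_measurePreserving (measurePreserving_eval (fun _ : Fin n => μ) k)
    exact (memLp_finsetSum Finset.univ fun k _ => h k).const_mul _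
  have hYint : ∫ x, Y x ∂P = ∫ y, ψ y ∂μ := by
    simp only [hY]
    rw [integral_const_mul, integral_finsetSum _ fun k _ =>
      integrable_comp_eval (hψL.integrable one_le_two)]
    rw [Finset.sum_congr rfl fun k _ =>
      integral_comp_eval (μ := fun _ : Fin n => μ) hψ.aestronglyMeasurable]
    simp [hn']
  have hZL : MemLp (fun x => |Y x - ∫ y, ψ y ∂μ|) 2 P := (hYL.sub (memLp_const _)).abs
  refine ⟨hZL.integrable one_le_two, ?_⟩
  have hvar : Var[Y; P] ≤ μ.real Q / n := by
    have h1 : Var[Y; P] = ((n : ℝ)⁻¹) ^ 2 * ∑ _k : Fin n, Var[ψ; μ] := by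
      rw [hY, variance_const_mul, ← variance_sum_pi (μ := fun _ : Fin n => μ) fun _ => hψL]
      congr 2
      ext x
      simp
    have h2 : Var[ψ; μ] ≤ μ.real Q := by
      refine (variance_le_expectation_sq hψ.aestronglyMeasurable).trans ?_
      rw [← integral_indicator_one hQ]
      refine integral_mono hψL.integrable_sq ((integrable_const 1).indicator hQ) fun x => ?_
      have h0 := hψQ x
      by_cases hx : x ∈ Q
      · simpa [hx] using hψ1 x
      · have : ψ x = 0 := by simpa [hx] using h0
        simp [this, hx]
    rw [h1, Finset.sum_const, Finset.card_univ, Fintype.card_fin, nsmul_eq_mul]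
    calc ((n : ℝ)⁻¹) ^ 2 * (n * Var[ψ; μ]) = Var[ψ; μ] / n := by field_simp
      _ ≤ μ.real Q / n := by gcongr
  refine Real.le_sqrt_of_sq_le (le_trans ?_ hvar)
  have h3 := variance_nonneg (fun x => |Y x - ∫ y, ψ y ∂μ|) P
  rw [variance_eq_sub hZL] at h3
  rw [variance_eq_integral hYm.aemeasurable, hYint]
  simpa using h3

theorem integral_ipm_empMeas_le [MeasurableSingletonClass X] {μ : Measure X}
    [IsProbabilityMeasure μ] {n : ℕ} (hn : 0 < n) {ι : Type*} {I : Finset ι} {ψ : ι → X → ℝ}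
    {Q : ι → Set X} {b : ι → ℝ} {g : X → ℝ} {F : Set (X → ℝ)}
    (hψ : ∀ i ∈ I, Measurable (ψ i)) (hQ : ∀ i ∈ I, MeasurableSet (Q i))
    (hψQ : ∀ i ∈ I, ∀ x, |ψ i x| ≤ (Q i).indicator (fun _ => 1) x)
    (hg : Integrable g μ) (hFne : F.Nonempty)
    (hF : ∀ f ∈ F, Integrable f μ ∧ ∃ a : ι → ℝ, (∀ i ∈ I, |a i| ≤ b i) ∧
      ∀ x, |f x - ∑ i ∈ I, a i * ψ i x| ≤ g x) :
    ∫ x : Fin n → X, ipm F (empMeas x) μ ∂(Measure.pi fun _ => μ) ≤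
      2 * ∫ x, g x ∂μ + ∑ i ∈ I, b i * √(μ.real (Q i) / n) := by
  have hn' : (n : ℝ) ≠ 0 := by positivity
  obtain ⟨f₀, hf₀⟩ := hFne
  obtain ⟨hf₀i, a₀, ha₀, hf₀g⟩ := hF f₀ hf₀
  have hg0 : ∀ x, 0 ≤ g x := fun x => (abs_nonneg _).trans (hf₀g x)
  have hb : ∀ i ∈ I, 0 ≤ b i := fun i hi => (abs_nonneg _).trans (ha₀ i hi)
  have hψi : ∀ i ∈ I, Integrable (ψ i) μ := fun i hi =>
    ((integrable_const (1 : ℝ)).indicator (hQ i hi)).mono' (hψ i hi).aestronglyMeasurable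
      (.of_forall fun x => hψQ i hi x)
  set P : Measure (Fin n → X) := Measure.pi fun _ => μ
  have hZ := fun i hi => integral_abs_mean_sub_le (μ := μ) hn (hψ i hi) (hQ i hi) (hψQ i hi)
  let Z : ι → (Fin n → X) → ℝ := fun i x => |(n : ℝ)⁻¹ * ∑ k, ψ i (x k) - ∫ y, ψ i y ∂μ|
  have hgP : ∀ k : Fin n, Integrable (fun x : Fin n → X => g (x k)) P := fun k =>
    integrable_comp_eval hg
  have hgm : Integrable (fun x : Fin n → X => (n : ℝ)⁻¹ * ∑ k, g (x k) + ∫ y, g y ∂μ) P :=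
    ((integrable_finsetSum _ fun k _ => hgP k).const_mul _).add (integrable_const _)
  have hbZ : Integrable (fun x => ∑ i ∈ I, b i * Z i x) P :=
    integrable_finsetSum _ fun i hi => (hZ i hi).1.const_mul _
  have hle : ∀ x : Fin n → X, ipm F (empMeas x) μ ≤
      ((n : ℝ)⁻¹ * ∑ k, g (x k) + ∫ y, g y ∂μ) + ∑ i ∈ I, b i * Z i x := by
    intro x
    refine Real.iSup_le (fun ⟨f, hf⟩ => ?_) ?_
    · obtain ⟨hfi, a, ha, hfg⟩ := hF f hf
      have hsi : Integrable (fun y => ∑ i ∈ I, a i * ψ i y) μ :=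
        integrable_finsetSum _ fun i hi => (hψi i hi).const_mul _
      have hri : Integrable (fun y => f y - ∑ i ∈ I, a i * ψ i y) μ := hfi.sub hsi
      have h1 : ∫ y, f y ∂μ =
          ∫ y, (f y - ∑ i ∈ I, a i * ψ i y) ∂μ + ∑ i ∈ I, a i * ∫ y, ψ i y ∂μ := by
        rw [integral_sub hfi hsi, integral_finsetSum _ fun i hi => (hψi i hi).const_mul _]
        simp_rw [integral_const_mul]
        ring
      have h2 : (n : ℝ)⁻¹ * ∑ k, f (x k) = (n : ℝ)⁻¹ * ∑ k, (f (x k) - ∑ i ∈ I, a i * ψ i (x k))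
          + ∑ i ∈ I, a i * ((n : ℝ)⁻¹ * ∑ k, ψ i (x k)) := by
        rw [Finset.sum_sub_distrib, Finset.sum_comm]
        simp_rw [← Finset.mul_sum, mul_left_comm _ (n : ℝ)⁻¹]
        rw [← Finset.mul_sum]
        ring
      have h3 : |∫ y, (f y - ∑ i ∈ I, a i * ψ i y) ∂μ| ≤ ∫ y, g y ∂μ :=
        (abs_integral_le_integral_abs).trans (integral_mono hri.abs hg hfg)
      have h4 : |(n : ℝ)⁻¹ * ∑ k, (f (x k) - ∑ i ∈ I, a i * ψ i (x k))| ≤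
          (n : ℝ)⁻¹ * ∑ k, g (x k) := by
        rw [abs_mul, abs_of_nonneg (by positivity : (0 : ℝ) ≤ (n : ℝ)⁻¹)]
        gcongr
        exact (Finset.abs_sum_le_sum_abs _ _).trans (Finset.sum_le_sum fun k _ => hfg _)
      have h5 : |∑ i ∈ I, a i * ((n : ℝ)⁻¹ * ∑ k, ψ i (x k)) - ∑ i ∈ I, a i * ∫ y, ψ i y ∂μ| ≤
          ∑ i ∈ I, b i * Z i x := by
        rw [← Finset.sum_sub_distrib]
        refine (Finset.abs_sum_le_sum_abs _ _).trans (Finset.sum_le_sum fun i hi => ?_)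
        rw [← mul_sub, abs_mul]
        exact mul_le_mul_of_nonneg_right (ha i hi) (abs_nonneg _)
      rw [integral_empMeas, h1, h2]
      rw [abs_le] at *
      constructor <;> linarith
    · have := integral_nonneg (μ := μ) (f := g) hg0
      have := Finset.sum_nonneg fun k (_ : k ∈ Finset.univ) => hg0 (x k)
      have := Finset.sum_nonneg fun i hi => mul_nonneg (hb i hi) (abs_nonneg _ : 0 ≤ Z i x)
      positivity
  calc ∫ x, ipm F (empMeas x) μ ∂P
      ≤ ∫ x, (((n : ℝ)⁻¹ * ∑ k, g (x k) + ∫ y, g y ∂μ) + ∑ i ∈ I, b i * Z i x) ∂P :=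
        integral_mono_of_nonneg (.of_forall fun x => Real.iSup_nonneg fun _ => abs_nonneg _)
          (hgm.add hbZ) (.of_forall hle)
    _ = 2 * ∫ x, g x ∂μ + ∑ i ∈ I, b i * ∫ x, Z i x ∂P := by
        rw [integral_add hgm hbZ, integral_add
          ((integrable_finsetSum _ fun k _ => hgP k).const_mul _) (integrable_const _),
          integral_const_mul, integral_finsetSum _ fun k _ => hgP k,
          integral_finsetSum _ fun i hi => (hZ i hi).1.const_mul _]
        have h : ∀ k : Fin n, ∫ x, g (x k) ∂P = ∫ y, g y ∂μ := fun k =>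
          integral_comp_eval (μ := fun _ : Fin n => μ) hg.aestronglyMeasurable
        simp only [integral_const_mul, h]
        simp [hn']
        ring
    _ ≤ _ := by
        gcongr with i hi
        · exact hb i hi
        · exact (hZ i hi).2

end Empirical

section Rate

lemma sum_sqrt_measureReal_preimage_le {X : Type*} [MeasurableSpace X] {μ : Measure X}
    [IsProbabilityMeasure μ] {S : Set X} (hS : MeasurableSet S) {p : X → X} {T : Finset X}
    (hp : ∀ c ∈ T, MeasurableSet (p ⁻¹' {c})) :
    ∑ c ∈ T, √(μ.real (S ∩ p ⁻¹' {c})) ≤ √(T.card : ℝ) := by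
  refine Real.le_sqrt_of_sq_le ((sq_sum_le_card_mul_sum_sq).trans ?_)
  simp only [Real.sq_sqrt measureReal_nonneg]
  have h : ∑ c ∈ T, μ.real (S ∩ p ⁻¹' {c}) ≤ 1 := by
    rw [← measureReal_biUnion_finset _ fun c hc => hS.inter (hp c hc)]
    · exact measureReal_le_one
    · intro c _ c' _ hcc
      refine disjoint_left.2 fun x hx hx' => hcc ?_
      exact hx.2.symm.trans hx'.2
  exact mul_le_of_le_one_right (by positivity) h

theorem exists_chaining_bound (d : ℕ) {β C : ℝ} (hβ : 0 < β) (hC : 0 < C) :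
    ∃ A : ℝ, 0 < A ∧ ∀ {μ : Measure (Fin d → ℝ)} [IsProbabilityMeasure μ]
      {S : ℕ → Set (Fin d → ℝ)} {T : ℕ → Finset (Fin d → ℝ)} {η t : ℝ} {J n : ℕ} {τ : ℕ → ℝ},
      0 < n → 0 < η → η * 4 ^ J ≤ 1 →
      (∀ j ≤ J, MeasurableSet (S j) ∧ μ.real (S j)ᶜ ≤ τ j ∧
        S j ⊆ ⋃ c ∈ T j, Metric.closedBall c (η * 4 ^ j) ∧
        ((T j).card : ℝ) ≤ (η * 4 ^ j) ^ (-t)) →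
      ∫ x : Fin n → (Fin d → ℝ), ipm (HolderClass d β C) (empMeas x) μ ∂(Measure.pi fun _ => μ) ≤
        A * (∑ j ∈ Finset.range (J + 1), τ j + η ^ β +
          (∑ j ∈ Finset.range J, (η * 4 ^ j) ^ (β - t / 2) + (η * 4 ^ J) ^ (-(t / 2))) / √n) := by
  classical
  obtain ⟨A, hA, hexp⟩ := exists_multiscale_expansion d hβ hC
  set w : ℝ := (Fintype.card (Fin ⌊β⌋₊ → Option (Fin d)) : ℝ) with hw
  refine ⟨2 * C + 2 * A + w * A, by positivity, ?_⟩
  intro μ _ S T η t J n τ hn hη hηJ hST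
  have hε : ∀ j, 0 < η * (4 : ℝ) ^ j := fun j => by positivity
  have hτ : ∀ j ∈ Finset.range (J + 1), 0 ≤ τ j := fun j hj =>
    measureReal_nonneg.trans (hST j (Nat.lt_succ_iff.1 (Finset.mem_range.1 hj))).2.1
  have hD : 0 ≤ ∑ j ∈ Finset.range (J + 1), τ j := Finset.sum_nonneg hτ
  have hE : 0 ≤ (∑ j ∈ Finset.range J, (η * 4 ^ j) ^ (β - t / 2) +
      (η * 4 ^ J) ^ (-(t / 2))) / √n := by
    have := (hε J).le
    have := Finset.sum_nonneg fun j (_ : j ∈ Finset.range J) =>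
      Real.rpow_nonneg (hε j).le (β - t / 2)
    positivity
  rcases (HolderClass d β C).eq_empty_or_nonempty with hF | hF
  · have h0 : ∀ x : Fin n → (Fin d → ℝ), ipm (HolderClass d β C) (empMeas x) μ = 0 := fun x => by
      rw [hF]
      exact Real.iSup_of_isEmpty _
    simp only [h0, integral_zero]
    positivity
  set S₀ : Set (Fin d → ℝ) := ⋂ j ∈ Finset.range (J + 1), S j with hS₀
  have hS₀m : MeasurableSet S₀ := Finset.measurableSet_biInter _ fun j hj =>
    (hST j (Nat.lt_succ_iff.1 (Finset.mem_range.1 hj))).1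
  have hS₀c : μ.real S₀ᶜ ≤ ∑ j ∈ Finset.range (J + 1), τ j := by
    rw [hS₀, compl_iInter₂]
    exact (measureReal_biUnion_finset_le _ _).trans (Finset.sum_le_sum fun j hj =>
      (hST j (Nat.lt_succ_iff.1 (Finset.mem_range.1 hj))).2.1)
  obtain ⟨π, par, hπ, hpar⟩ := exists_covering_tree (S := S₀) (T := T) hη.le J fun j hj =>
    (biInter_subset_of_mem (Finset.mem_range.2 (Nat.lt_succ_of_le hj))).trans (hST j hj).2.2.1
  let W := Fin ⌊β⌋₊ → Option (Fin d)
  let Q : ℕ → (Fin d → ℝ) → Set (Fin d → ℝ) := fun j c => S₀ ∩ π j ⁻¹' {c}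
  have hQ : ∀ j c, MeasurableSet (Q j c) := fun j c =>
    hS₀m.inter ((π j).measurableSet_preimage _)
  let b : ℕ → ℝ := fun j => A * if j < J then (η * 4 ^ j) ^ β else 1
  have hb : ∀ j, 0 ≤ b j := fun j => by
    have := (hε j).le
    simp only [b]
    split_ifs <;> positivity
  let I : Finset (Σ _ : ℕ, (Fin d → ℝ) × W) :=
    (Finset.range (J + 1)).sigma fun j => T j ×ˢ Finset.univ
  have hI : ∀ i ∈ I, i.1 ≤ J := fun i hi =>
    Nat.lt_succ_iff.1 (Finset.mem_range.1 (Finset.mem_sigma.1 hi).1)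
  have hmain := integral_ipm_empMeas_le (μ := μ) (F := HolderClass d β C) hn (I := I)
    (ψ := fun i => (Q i.1 i.2.1).indicator
      fun x => wordMonomial i.2.2 ((2 * (η * 4 ^ i.1))⁻¹ • (x - i.2.1)))
    (Q := fun i => Q i.1 i.2.1) (b := fun i => b i.1)
    (g := fun x => S₀ᶜ.indicator (fun _ => C) x + A * η ^ β)
    (fun i _ => (((continuous_wordMonomial _).comp (by fun_prop)).measurable).indicator (hQ _ _))
    (fun i _ => hQ _ _)
    (fun i hi x => by
      by_cases hx : x ∈ Q i.1 i.2.1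
      · rw [indicator_of_mem hx, indicator_of_mem hx]
        refine abs_wordMonomial_le_one _ ?_
        have h1 := (hπ i.1 (hI i hi) x hx.1).2
        rw [show π i.1 x = i.2.1 from hx.2, dist_eq_norm] at h1
        have := hε i.1
        rw [norm_smul, norm_inv, Real.norm_of_nonneg (by positivity)]
        rw [inv_mul_le_iff₀ (by positivity), mul_one]
        exact h1
      · simp [hx])
    (((integrable_const C).indicator hS₀m.compl).add (integrable_const _)) hF
    (fun f hf => by
      refine ⟨?_, ?_⟩
      · exact Integrable.mono' (integrable_const C) hf.1.continuous.aestronglyMeasurable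
          (.of_forall fun x => abs_le_of_mem_holderClass hC hf x)
      · obtain ⟨a, ha, haf⟩ := hexp hη hηJ hπ hpar f hf
        refine ⟨fun i => a i.1 i.2.1 i.2.2, fun i _ => ha _ _ _, fun x => ?_⟩
        simp only [I, Finset.sum_sigma, Finset.sum_product]
        exact haf x)
  refine hmain.trans ?_
  have hg : ∫ x, (S₀ᶜ.indicator (fun _ => C) x + A * η ^ β) ∂μ ≤
      C * ∑ j ∈ Finset.range (J + 1), τ j + A * η ^ β := by
    rw [integral_add ((integrable_const C).indicator hS₀m.compl) (integrable_const _),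
      integral_indicator_const _ hS₀m.compl]
    simp only [integral_const, probReal_univ, smul_eq_mul, one_mul]
    rw [mul_comm C]
    gcongr
  have hscale : ∀ j ≤ J, ∑ c ∈ T j, ∑ _σ : W, b j * √(μ.real (Q j c) / n) ≤
      w * b j * (η * 4 ^ j) ^ (-(t / 2)) / √n := by
    intro j hj
    have h1 := sum_sqrt_measureReal_preimage_le (μ := μ) hS₀m (p := π j) (T := T j)
      fun c _ => (π j).measurableSet_preimage _
    have h2 : √((T j).card : ℝ) ≤ (η * 4 ^ j) ^ (-(t / 2)) := by
      refine (Real.sqrt_le_sqrt (hST j hj).2.2.2).trans_eq ?_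
      rw [Real.sqrt_eq_rpow, ← Real.rpow_mul (hε j).le]
      ring_nf
    calc ∑ c ∈ T j, ∑ _σ : W, b j * √(μ.real (Q j c) / n)
        = w * b j * (∑ c ∈ T j, √(μ.real (Q j c))) / √n := by
          simp only [Finset.sum_const, Finset.card_univ, nsmul_eq_mul, Real.sqrt_div
            measureReal_nonneg, Finset.mul_sum, Finset.sum_div]
          exact Finset.sum_congr rfl fun c _ => by rw [hw]; ring
      _ ≤ _ := by
          have := hb j
          gcongr
          exact h1.trans h2
  have hsum : ∑ i ∈ I, b i.1 * √(μ.real (Q i.1 i.2.1) / n) ≤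
      w * A * ((∑ j ∈ Finset.range J, (η * 4 ^ j) ^ (β - t / 2) +
        (η * 4 ^ J) ^ (-(t / 2))) / √n) := by
    simp only [I, Finset.sum_sigma, Finset.sum_product]
    refine (Finset.sum_le_sum fun j hj =>
      hscale j (Nat.lt_succ_iff.1 (Finset.mem_range.1 hj))).trans_eq ?_
    rw [Finset.sum_range_succ, add_div, mul_add, Finset.sum_div, Finset.mul_sum]
    congr 1
    · refine Finset.sum_congr rfl fun j hj => ?_
      simp only [b, if_pos (Finset.mem_range.1 hj)]
      rw [sub_eq_add_neg, Real.rpow_add (hε j)]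
      ring
    · simp only [b, lt_irrefl, if_false]
      ring
  have hηβ : 0 ≤ η ^ β := by positivity
  have hw0 : 0 ≤ w := by positivity
  nlinarith [mul_nonneg hC.le hηβ, mul_nonneg hC.le hE, mul_nonneg hA.le hD, mul_nonneg hA.le hE,
    mul_nonneg (mul_nonneg hw0 hA.le) hD, mul_nonneg (mul_nonneg hw0 hA.le) hηβ]

lemma sum_scale_rpow_le_last {η θ : ℝ} (hη : 0 < η) (hθ : 0 < θ) (J : ℕ) :
    ∑ j ∈ Finset.range (J + 1), (η * 4 ^ j) ^ θ ≤
      (4 : ℝ) ^ θ / (4 ^ θ - 1) * (η * 4 ^ J) ^ θ := by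
  have hρ : (1 : ℝ) < 4 ^ θ := Real.one_lt_rpow (by norm_num) hθ
  have hρ' : (4 : ℝ) ^ θ - 1 ≠ 0 := by linarith
  induction J with
  | zero =>
    simp only [zero_add, Finset.range_one, Finset.sum_singleton]
    refine le_mul_of_one_le_left (by positivity) ?_
    rw [one_le_div (by linarith)]
    linarith
  | succ J ih =>
    rw [Finset.sum_range_succ]
    have h : (η * 4 ^ (J + 1)) ^ θ = 4 ^ θ * (η * 4 ^ J) ^ θ := by
      rw [← Real.mul_rpow (by norm_num) (by positivity)]
      ring_nf
    rw [h]
    refine (add_le_add_left ih _).trans_eq ?_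
    field_simp
    ring

lemma sum_scale_rpow_le_first {η s : ℝ} (hη : 0 < η) (hs : s < 0) (J : ℕ) :
    ∑ j ∈ Finset.range J, (η * 4 ^ j) ^ s ≤ (1 - (4 : ℝ) ^ s)⁻¹ * η ^ s := by
  have hq : (4 : ℝ) ^ s < 1 := Real.rpow_lt_one_of_one_lt_of_neg (by norm_num) hs
  have hq0 : (0 : ℝ) ≤ 4 ^ s := by positivity
  have h : ∀ j : ℕ, (η * 4 ^ j) ^ s = η ^ s * ((4 : ℝ) ^ s) ^ j := fun j => by
    rw [Real.mul_rpow hη.le (by positivity), ← Real.rpow_natCast, ← Real.rpow_mul (by norm_num),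
      mul_comm (j : ℝ), Real.rpow_mul (by norm_num), Real.rpow_natCast]
  simp only [h, ← Finset.mul_sum]
  rw [mul_comm, ← tsum_geometric_of_lt_one hq0 hq]
  gcongr
  exact (summable_geometric_of_lt_one hq0 hq).sum_le_tsum _ fun _ _ => by positivity

lemma exists_scales {β t ε₀ : ℝ} (hβ : 0 < β) (ht : 2 * β < t) (hε₀ : 0 < ε₀) :
    ∃ (n₀ : ℕ) (K : ℝ), 0 < n₀ ∧ 0 < K ∧ ∀ n : ℕ, n₀ ≤ n → ∃ (η : ℝ) (J : ℕ),
      0 < η ∧ η * 4 ^ J < ε₀ ∧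
      ∑ j ∈ Finset.range (J + 1), (η * 4 ^ j) ^ (t * β / (t - 2 * β)) + η ^ β +
          (∑ j ∈ Finset.range J, (η * 4 ^ j) ^ (β - t / 2) + (η * 4 ^ J) ^ (-(t / 2))) / √n ≤
        K * (n : ℝ) ^ (-(β / t)) := by
  have ht0 : 0 < t := by linarith
  have hδ : 0 < t - 2 * β := by linarith
  set θ := t * β / (t - 2 * β) with hθ
  have hθ0 : 0 < θ := by positivity
  have hs : β - t / 2 < 0 := by linarith
  have hρ : (1 : ℝ) < 4 ^ θ := Real.one_lt_rpow (by norm_num) hθ0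
  have hq : (4 : ℝ) ^ (β - t / 2) < 1 := Real.rpow_lt_one_of_one_lt_of_neg (by norm_num) hs
  have hK₁ : 0 < (4 : ℝ) ^ θ / (4 ^ θ - 1) := div_pos (by positivity) (by linarith)
  have hK₂ : 0 < (1 - (4 : ℝ) ^ (β - t / 2))⁻¹ := inv_pos.2 (by linarith)
  have hlim : Tendsto (fun n : ℕ => (n : ℝ) ^ (-((t - 2 * β) / t ^ 2))) atTop (𝓝 0) :=
    (tendsto_rpow_neg_atTop (by positivity)).comp tendsto_natCast_atTop_atTop
  obtain ⟨n₁, hn₁⟩ := eventually_atTop.1 (hlim.eventually_lt_const hε₀)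
  refine ⟨n₁ + 1, 4 ^ θ / (4 ^ θ - 1) + 1 + (1 - (4 : ℝ) ^ (β - t / 2))⁻¹ + 4 ^ (t / 2),
    by omega, by positivity, fun n hn => ?_⟩
  have hn1 : (1 : ℝ) ≤ n := by exact_mod_cast (by omega : 1 ≤ n)
  have hn0 : (0 : ℝ) < n := by linarith
  have hEε := hn₁ n (by omega)
  set E : ℝ := (n : ℝ) ^ (-((t - 2 * β) / t ^ 2)) with hE
  set η : ℝ := (n : ℝ) ^ (-(1 / t)) with hη
  have hη0 : 0 < η := by positivity
  have hEη : 1 ≤ E / η := by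
    rw [hE, hη, ← Real.rpow_sub hn0]
    refine Real.one_le_rpow hn1 ?_
    have : -((t - 2 * β) / t ^ 2) - -(1 / t) = 2 * β / t ^ 2 := by
      field_simp
      ring
    rw [this]
    positivity
  obtain ⟨J, hJ₁, hJ₂⟩ := exists_nat_pow_near hEη (by norm_num : (1 : ℝ) < 4)
  have hJE : η * 4 ^ J ≤ E := by
    rwa [le_div_iff₀ hη0, mul_comm] at hJ₁
  have hEJ : E / 4 ≤ η * 4 ^ J := by
    rw [div_lt_iff₀ hη0, pow_succ] at hJ₂
    linarith
  refine ⟨η, J, hη0, hJE.trans_lt hEε, ?_⟩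
  have hsqrt : √(n : ℝ) = (n : ℝ) ^ (1 / 2 : ℝ) := Real.sqrt_eq_rpow _
  have h₁ : ∑ j ∈ Finset.range (J + 1), (η * 4 ^ j) ^ θ ≤
      4 ^ θ / (4 ^ θ - 1) * (n : ℝ) ^ (-(β / t)) := by
    refine (sum_scale_rpow_le_last hη0 hθ0 J).trans ?_
    gcongr
    refine (Real.rpow_le_rpow (by positivity) hJE hθ0.le).trans_eq ?_
    rw [hE, ← Real.rpow_mul hn0.le, hθ]
    congr 1
    field_simp
  have h₂ : η ^ β = (n : ℝ) ^ (-(β / t)) := by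
    rw [hη, ← Real.rpow_mul hn0.le]
    ring_nf
  have h₃ : (∑ j ∈ Finset.range J, (η * 4 ^ j) ^ (β - t / 2)) / √n ≤
      (1 - (4 : ℝ) ^ (β - t / 2))⁻¹ * (n : ℝ) ^ (-(β / t)) := by
    have h : η ^ (β - t / 2) / √n = (n : ℝ) ^ (-(β / t)) := by
      rw [hη, hsqrt, ← Real.rpow_mul hn0.le, ← Real.rpow_sub hn0]
      congr 1
      field_simp
      ring
    rw [← h, ← mul_div_assoc]
    gcongr
    exact sum_scale_rpow_le_first hη0 hs J
  have h₄ : (η * 4 ^ J) ^ (-(t / 2)) / √n ≤ 4 ^ (t / 2) * (n : ℝ) ^ (-(β / t)) := by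
    have h : (E / 4) ^ (-(t / 2)) / √n = 4 ^ (t / 2) * (n : ℝ) ^ (-(β / t)) := by
      rw [Real.div_rpow (by positivity) (by norm_num), Real.rpow_neg (by norm_num : (0 : ℝ) ≤ 4),
        div_inv_eq_mul, mul_comm, mul_div_assoc, hE, hsqrt, ← Real.rpow_mul hn0.le,
        ← Real.rpow_sub hn0]
      congr 2
      field_simp
      ring
    rw [← h]
    gcongr ?_ / _
    exact Real.rpow_le_rpow_of_nonpos (by positivity) hEJ (by linarith)
  rw [add_div, h₂]
  linarith

lemma natCast_le_rpow_of_dimRatio_lt {N : ℕ∞} {ε t : ℝ} (hε : 0 < ε) (hε1 : ε < 1)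
    (h : dimRatio N ε < (t : EReal)) : ∃ k : ℕ, N = k ∧ (k : ℝ) ≤ ε ^ (-t) := by
  have hlog : 0 < Real.log (1 / ε) := Real.log_pos (by rwa [lt_div_iff₀ hε, one_mul])
  have hinv : 0 < (Real.log (1 / ε))⁻¹ := inv_pos.2 hlog
  induction N using ENat.recTopCoe with
  | top =>
    simp only [dimRatio, elog, ENat.toENNReal_top, ENNReal.top_ne_zero, if_false, if_true,
      EReal.top_mul_coe_of_pos hinv] at h
    exact absurd h (not_lt.2 le_top)
  | coe k =>
    refine ⟨k, rfl, ?_⟩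
    rcases Nat.eq_zero_or_pos k with rfl | hk
    · simp only [Nat.cast_zero]
      positivity
    have hk0 : (0 : ℝ) < k := by exact_mod_cast hk
    simp only [dimRatio, elog, ENat.toENNReal_coe, Nat.cast_eq_zero, hk.ne', if_false,
      ENNReal.natCast_ne_top, ENNReal.toReal_natCast] at h
    rw [← EReal.coe_mul, EReal.coe_lt_coe_iff, ← div_eq_mul_inv, div_lt_iff₀ hlog] at h
    rw [← Real.log_le_log_iff hk0 (by positivity), Real.log_rpow hε]
    rw [one_div, Real.log_inv] at h
    linarith

lemma exists_cover_of_measCoverNFam_eq {X : Type*} [PseudoMetricSpace X] [MeasurableSpace X]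
    {Λ : Set (Measure X)} {ε τ : ℝ} {k : ℕ} (h : measCoverNFam Λ ε τ = k) :
    ∃ S : Set X, MeasurableSet S ∧ (∀ μ ∈ Λ, ENNReal.ofReal (1 - τ) ≤ μ S) ∧
      ∃ T : Finset X, S ⊆ ⋃ c ∈ T, Metric.closedBall c ε ∧ T.card ≤ k := by
  have h1 : measCoverNFam Λ ε τ < ((k + 1 : ℕ) : ℕ∞) := by
    rw [h]
    exact_mod_cast k.lt_succ_self
  simp only [measCoverNFam, coverN, iInf_lt_iff] at h1
  obtain ⟨S, hS, hSΛ, T, hT, hTk⟩ := h1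
  exact ⟨S, hS, hSΛ, T, hT, Nat.lt_succ_iff.1 (by exact_mod_cast hTk)⟩

theorem exists_cover_of_upperWDimFam_lt {X : Type*} [PseudoMetricSpace X] [MeasurableSpace X]
    {Λ : Set (Measure X)} (hΛ : ∀ μ ∈ Λ, IsProbabilityMeasure μ) {β t : ℝ} (hβ : 0 < β)
    (h : upperWDimFam Λ β < (t : EReal)) :
    2 * β < t ∧ ∃ ε₀ : ℝ, 0 < ε₀ ∧ ε₀ ≤ 1 ∧ ∀ ε : ℝ, 0 < ε → ε < ε₀ →
      ∃ (S : Set X) (T : Finset X), MeasurableSet S ∧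
        (∀ μ ∈ Λ, μ.real Sᶜ ≤ ε ^ (t * β / (t - 2 * β))) ∧
        S ⊆ ⋃ c ∈ T, Metric.closedBall c ε ∧ (T.card : ℝ) ≤ ε ^ (-t) := by
  obtain ⟨_, ⟨s, rfl, hs, hlim⟩, hst⟩ := sInf_lt_iff.1 h
  have hst' : s < t := EReal.coe_lt_coe_iff.1 hst
  refine ⟨hs.trans hst', ?_⟩
  have hev := eventually_lt_of_limsup_lt (hlim.trans_lt hst)
  obtain ⟨u, hu, hu'⟩ := mem_nhdsGT_iff_exists_Ioo_subset.1 hev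
  refine ⟨min u 1, lt_min hu one_pos, min_le_right _ _, fun ε hε hεu => ?_⟩
  have hε1 := hεu.trans_le (min_le_right _ _)
  obtain ⟨k, hk, hkε⟩ := natCast_le_rpow_of_dimRatio_lt hε hε1
    (hu' ⟨hε, hεu.trans_le (min_le_left _ _)⟩)
  obtain ⟨S, hS, hSΛ, T, hT, hTk⟩ := exists_cover_of_measCoverNFam_eq hk
  refine ⟨S, T, hS, fun μ hμ => ?_, hT, le_trans (by exact_mod_cast hTk) hkε⟩
  have := hΛ μ hμ
  have hexp : t * β / (t - 2 * β) ≤ s * β / (s - 2 * β) := by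
    rw [div_le_div_iff₀ (by linarith) (by linarith)]
    nlinarith [mul_pos (mul_pos hβ hβ) (sub_pos.2 hst')]
  have h1 : 1 - ε ^ (s * β / (s - 2 * β)) ≤ μ.real S :=
    (ENNReal.ofReal_le_iff_le_toReal (measure_ne_top _ _)).1 (hSΛ μ hμ)
  have h2 := Real.rpow_le_rpow_of_exponent_ge hε hε1.le hexp
  rw [probReal_compl_eq_one_sub hS]
  linarith

end Rate

/-- Let `Λ` be a family of Borel probability measures on `[0,1]^d`, `β > 0`,
`C > 0` and `F = H^β(ℝ^d, ℝ, C)`.  For every `d⋆ > d*_β(Λ)` there are `n₀ ∈ ℕ` and `K > 0`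
such that for all `n ≥ n₀`, `sup_{μ ∈ Λ} E ‖μ̂_n − μ‖_F ≤ K n^{-β/d⋆}`. -/
theorem uniform_expected_empirical_holder_ipm_rate
    (d : ℕ) (Λ : Set (Measure (Fin d → ℝ)))
    (hΛ : ∀ μ ∈ Λ, IsProbabilityMeasure μ ∧ μ (Set.Icc 0 1) = 1)
    (β C : ℝ) (hβ : 0 < β) (hC : 0 < C)
    (dstar : ℝ) (hdstar : upperWDimFam Λ β < (dstar : EReal)) :
    ∃ (n₀ : ℕ) (K : ℝ), 0 < K ∧ ∀ n : ℕ, n₀ ≤ n → ∀ μ ∈ Λ,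
      (∫ x : Fin n → (Fin d → ℝ),
          ipm (HolderClass d β C) (empMeas x) μ ∂(Measure.pi fun _ => μ))
        ≤ K * (n : ℝ) ^ (-(β / dstar)) := by
  have hprob : ∀ μ ∈ Λ, IsProbabilityMeasure μ := fun μ hμ => (hΛ μ hμ).1
  obtain ⟨ht, ε₀, hε₀, hε₀1, hcover⟩ := exists_cover_of_upperWDimFam_lt hprob hβ hdstar
  obtain ⟨A, hA, hchain⟩ := exists_chaining_bound d hβ hC
  obtain ⟨n₀, K, hn₀, hK, hscales⟩ := exists_scales hβ ht hε₀
  refine ⟨n₀, A * K, by positivity, fun n hn μ hμ => ?_⟩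
  obtain ⟨η, J, hη, hηJ, hbound⟩ := hscales n hn
  have hlt : ∀ j ≤ J, η * 4 ^ j < ε₀ := fun j hj => lt_of_le_of_lt (by gcongr; norm_num) hηJ
  have hex : ∀ j, ∃ (S : Set (Fin d → ℝ)) (T : Finset (Fin d → ℝ)), j ≤ J →
      MeasurableSet S ∧ (∀ μ ∈ Λ, μ.real Sᶜ ≤ (η * 4 ^ j) ^ (dstar * β / (dstar - 2 * β))) ∧
        S ⊆ ⋃ c ∈ T, Metric.closedBall c (η * 4 ^ j) ∧ (T.card : ℝ) ≤ (η * 4 ^ j) ^ (-dstar) := by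
    intro j
    by_cases hj : j ≤ J
    · obtain ⟨S, T, h⟩ := hcover (η * 4 ^ j) (by positivity) (hlt j hj)
      exact ⟨S, T, fun _ => h⟩
    · exact ⟨∅, ∅, fun h => absurd h hj⟩
  choose S T hST using hex
  have := hprob μ hμ
  refine (hchain (μ := μ) (by omega) hη (hηJ.le.trans hε₀1) fun j hj =>
    ⟨(hST j hj).1, (hST j hj).2.1 μ hμ, (hST j hj).2.2.1, (hST j hj).2.2.2⟩).trans ?_
  rw [mul_assoc]
  gcongr
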